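/- Let r ∈ (0,1), let s_1,…,s_m be linear isometries of ℝ^d, v_1,…,v_m ∈ ℝ^d, let F = {f_k(x) = r·(s_k(x) + v_k)} be the resulting IFS with attractor A, assume 0 ∈ A, and set C = 2r·max_k ‖v_k‖/(1 − r). Then F is of finite type (the set of proper neighbor maps is finite) if and only if the set of all neighbor maps h with ‖v(h)‖ ≤ C is finite. -/

import Mathlib

/-- Composition of the maps of an IFS along a word of indices:
`wordComp f [i₁,…,iₙ] = f i₁ ∘ ⋯ ∘ f iₙ`. -/
def wordComp {E : Type*} {m : ℕ} (f : Fin m → E → E) : List (Fin m) → E → E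
  | [] => id
  | i :: w => f i ∘ wordComp f w

/-- Neighbor maps of the IFS `F = {f 1, …, f m}`: maps `h = f⁻¹ ∘ g` with
`f, g ∈ F^n` for some `n ≥ 1`, encoded by the equation `f ∘ h = g`. -/
def neighborMaps {E : Type*} {m : ℕ} (f : Fin m → E → E) : Set (E → E) :=
  {h | ∃ u w : List (Fin m), u ≠ [] ∧ u.length = w.length ∧
      wordComp f u ∘ h = wordComp f w}

section Words

variable {E : Type*} {m : ℕ} {f : Fin m → E → E}

theorem wordComp_append (u w : List (Fin m)) :
    wordComp f (u ++ w) = wordComp f u ∘ wordComp f w := by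
  induction u with
  | nil => rfl
  | cons i u ih => rw [List.cons_append, wordComp, ih, wordComp, Function.comp_assoc]

theorem wordComp_concat (u : List (Fin m)) (i : Fin m) :
    wordComp f (u ++ [i]) = wordComp f u ∘ f i := by
  rw [wordComp_append]; rfl

theorem wordComp_bijective (hf : ∀ i, Function.Bijective (f i)) (u : List (Fin m)) :
    Function.Bijective (wordComp f u) := by
  induction u with
  | nil => exact Function.bijective_id
  | cons i u ih => exact (hf i).comp ih

/-- For bijective maps, a quotient `(wordComp f u)⁻¹ ∘ wordComp f w` exists. -/
theorem exists_wordComp_comp_eq (hf : ∀ i, Function.Bijective (f i)) (u w : List (Fin m)) :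
    ∃ h : E → E, wordComp f u ∘ h = wordComp f w := by
  choose g hg using (wordComp_bijective hf u).surjective
  exact ⟨g ∘ wordComp f w, funext fun x => hg _⟩

/-- The maps `(f i)⁻¹ ∘ h ∘ f j` with `h ∈ S`, encoded by the equation `f i ∘ h' = h ∘ f j`. -/
def successors (f : Fin m → E → E) (S : Set (E → E)) : Set (E → E) :=
  {h' | ∃ h ∈ S, ∃ i j, f i ∘ h' = h ∘ f j}

theorem finite_successors (hf : ∀ i, Function.Injective (f i)) {S : Set (E → E)}
    (hS : S.Finite) : (successors f S).Finite := by
  have heq : successors f S = ⋃ h ∈ S, ⋃ i, ⋃ j, {h' | f i ∘ h' = h ∘ f j} := by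
    ext h'; simp [successors]
  rw [heq]
  refine hS.biUnion fun h _ => Set.finite_iUnion fun i => Set.finite_iUnion fun j => ?_
  exact Set.Subsingleton.finite fun a ha b hb =>
    (hf i).comp_left (ha.trans hb.symm)

theorem finite_iterate_successors (hf : ∀ i, Function.Injective (f i)) {S : Set (E → E)}
    (hS : S.Finite) (n : ℕ) : ((successors f)^[n] S).Finite := by
  induction n with
  | zero => exact hS
  | succ n ih =>
    rw [Function.iterate_succ_apply']
    exact finite_successors hf ih

theorem id_mem_neighborMaps (hm : 0 < m) : id ∈ neighborMaps f :=
  ⟨[⟨0, hm⟩], [⟨0, hm⟩], by simp, rfl, rfl⟩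

end Words

section Metric

variable {E : Type*} [MetricSpace E] {m : ℕ} {f : Fin m → E → E} {r : ℝ}

theorem dist_wordComp (hf : ∀ i x y, dist (f i x) (f i y) = r * dist x y)
    (u : List (Fin m)) (x y : E) :
    dist (wordComp f u x) (wordComp f u y) = r ^ u.length * dist x y := by
  induction u with
  | nil => simp [wordComp]
  | cons i u ih =>
    simp only [wordComp, Function.comp_apply, hf, ih, List.length_cons]
    ring

theorem isometry_of_mem_neighborMaps (hr : 0 < r)
    (hf : ∀ i x y, dist (f i x) (f i y) = r * dist x y)
    {h : E → E} (hh : h ∈ neighborMaps f) : Isometry h := by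
  obtain ⟨u, w, -, hl, he⟩ := hh
  refine Isometry.of_dist_eq fun x y => ?_
  have h1 := dist_wordComp hf u (h x) (h y)
  have h2 := dist_wordComp hf w x y
  rw [← he, Function.comp_apply, Function.comp_apply, h1, hl] at h2
  exact mul_left_cancel₀ (pow_pos hr _).ne' h2

/-- Finitely many continuous images of a compact set `A`, all disjoint from `A`, stay at a
uniformly positive distance from `A`. -/
theorem exists_forall_le_dist_of_finite {A : Set E} (hA : IsCompact A) {T : Set (E → E)}
    (hT : T.Finite) (hcont : ∀ h ∈ T, Continuous h) (hdisj : ∀ h ∈ T, Disjoint A (h '' A)) :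
    ∃ δ > 0, ∀ h ∈ T, ∀ x ∈ A, ∀ y ∈ A, δ ≤ dist x (h y) := by
  induction T, hT using Set.Finite.induction_on with
  | empty => exact ⟨1, one_pos, by simp⟩
  | @insert h T _ _ ih =>
    obtain ⟨δ, hδ, hle⟩ := ih (fun g hg => hcont g (Set.mem_insert_of_mem _ hg))
      (fun g hg => hdisj g (Set.mem_insert_of_mem _ hg))
    obtain ⟨ε, hε, hlt⟩ := Metric.exists_pos_forall_lt_edist hA
      (hA.image (hcont h (Set.mem_insert _ _))).isClosed (hdisj h (Set.mem_insert _ _))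
    refine ⟨min δ ε, lt_min hδ hε, ?_⟩
    rintro g (rfl | hg) x hx y hy
    · have := hlt x hx (g y) (Set.mem_image_of_mem g hy)
      rw [edist_nndist, ENNReal.coe_lt_coe] at this
      exact (min_le_right _ _).trans (NNReal.coe_le_coe.2 this.le)
    · exact (min_le_left _ _).trans (hle g hg x hx y hy)

/-- Every neighbor map `h` is either proper or arises by `k` refinements from a non-proper
refinement of a proper neighbor map, in which case `A` and `h '' A` are at distance at least
`δ / rᵏ`. -/
theorem proper_or_mem_iterate_successors (hm : 0 < m)
    (hf : ∀ i x y, dist (f i x) (f i y) = r * dist x y)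
    (hbij : ∀ i, Function.Bijective (f i)) {A : Set E} (hAne : A.Nonempty)
    (hA : ∀ i, ∀ x ∈ A, f i x ∈ A) {P T : Set (E → E)}
    (hP : P = {h | h ∈ neighborMaps f ∧ (A ∩ h '' A).Nonempty})
    (hT : T = (successors f P ∩ neighborMaps f) \ P) {δ : ℝ}
    (hδ : ∀ h ∈ T, ∀ x ∈ A, ∀ y ∈ A, δ ≤ dist x (h y)) (u w : List (Fin m))
    (hl : u.length = w.length) (h : E → E) (hh : wordComp f u ∘ h = wordComp f w) :
    h ∈ P ∨ ∃ k, h ∈ (successors f)^[k] T ∧ ∀ x ∈ A, ∀ y ∈ A, δ ≤ r ^ k * dist x (h y) := by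
  induction u using List.reverseRecOn generalizing w h with
  | nil =>
    obtain rfl : w = [] := List.length_eq_zero_iff.1 hl.symm
    left
    obtain rfl : h = id := hh
    rw [hP]
    exact ⟨id_mem_neighborMaps hm, by simpa using hAne⟩
  | append_singleton u i ih =>
    have hmem : h ∈ neighborMaps f := ⟨u ++ [i], w, by simp, hl, hh⟩
    rcases w.eq_nil_or_concat with rfl | ⟨w, j, rfl⟩
    · simp at hl
    rw [List.concat_eq_append] at *
    obtain ⟨g, hg⟩ := exists_wordComp_comp_eq hbij u w
    have hgh : f i ∘ h = g ∘ f j := by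
      apply (wordComp_bijective hbij u).injective.comp_left
      simpa only [wordComp_concat, Function.comp_assoc, ← hg] using hh
    rcases ih w (by simpa using hl) g hg with hgP | ⟨k, hgk, hk⟩
    · by_cases hhP : h ∈ P
      · exact Or.inl hhP
      have hhT : h ∈ T := by rw [hT]; exact ⟨⟨⟨g, hgP, i, j, hgh⟩, hmem⟩, hhP⟩
      exact Or.inr ⟨0, hhT, by simpa using hδ h hhT⟩
    · refine Or.inr ⟨k + 1, ?_, fun x hx y hy => ?_⟩
      · rw [Function.iterate_succ_apply']
        exact ⟨g, hgk, i, j, hgh⟩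
      · have hd := hk (f i x) (hA i x hx) (f j y) (hA j y hy)
        have he : g (f j y) = f i (h y) := (congrFun hgh y).symm
        rwa [he, hf, ← mul_assoc, ← pow_succ] at hd

/-- If an equal-ratio IFS has finitely many proper neighbor maps, then only finitely many
neighbor maps move a given point of the attractor by at most `C`. -/
theorem finite_neighborMaps_dist_le (hr : 0 < r) (hr1 : r < 1) (hm : 0 < m)
    (hf : ∀ i x y, dist (f i x) (f i y) = r * dist x y)
    (hbij : ∀ i, Function.Bijective (f i)) {A : Set E} (hAcp : IsCompact A)
    (hA : ∀ i, ∀ x ∈ A, f i x ∈ A) {a : E} (ha : a ∈ A)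
    (hfin : {h | h ∈ neighborMaps f ∧ (A ∩ h '' A).Nonempty}.Finite) (C : ℝ) :
    {h | h ∈ neighborMaps f ∧ dist a (h a) ≤ C}.Finite := by
  obtain ⟨P, hP⟩ : ∃ P, P = {h | h ∈ neighborMaps f ∧ (A ∩ h '' A).Nonempty} := ⟨_, rfl⟩
  obtain ⟨T, hT⟩ : ∃ T, T = (successors f P ∩ neighborMaps f) \ P := ⟨_, rfl⟩
  rw [← hP] at hfin
  have hinj : ∀ i, Function.Injective (f i) := fun i => (hbij i).injective
  have hTfin : T.Finite := by
    rw [hT]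
    exact (finite_successors hinj hfin).subset fun h hh => hh.1.1
  obtain ⟨δ, hδ0, hδ⟩ := exists_forall_le_dist_of_finite hAcp hTfin
    (fun h hh => by
      rw [hT] at hh
      exact (isometry_of_mem_neighborMaps hr hf hh.1.2).continuous)
    (fun h hh => by
      rw [hT, hP] at hh
      rw [Set.disjoint_iff_inter_eq_empty, ← Set.not_nonempty_iff_eq_empty]
      exact fun hne => hh.2 ⟨hh.1.2, hne⟩)
  have hlim : Filter.Tendsto (fun k : ℕ => r ^ k * C) Filter.atTop (nhds 0) := by
    simpa using (tendsto_pow_atTop_nhds_zero_of_lt_one hr.le hr1).mul_const C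
  obtain ⟨N, hN⟩ := Filter.eventually_atTop.1 (hlim.eventually_lt_const hδ0)
  refine (hfin.union ((Set.finite_lt_nat N).biUnion fun k _ =>
    finite_iterate_successors hinj hTfin k)).subset ?_
  rintro h ⟨⟨u, w, -, hl, he⟩, hC⟩
  rcases proper_or_mem_iterate_successors hm hf hbij ⟨a, ha⟩ hA hP hT hδ u w hl h he with
    hh | ⟨k, hk, hd⟩
  · exact Or.inl hh
  · refine Or.inr (Set.mem_biUnion (show k < N from ?_) hk)
    by_contra! hNk
    exact absurd ((hd a ha a ha).trans (mul_le_mul_of_nonneg_left hC (pow_pos hr k).le))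
      (hN k hNk).not_ge

end Metric

/-- The attractor of the IFS `x ↦ r • (s k x + v k)` lies in the ball of radius
`r * max ‖v k‖ / (1 - r)` around the origin. -/
theorem norm_le_of_mem_attractor {E : Type*} [NormedAddCommGroup E] [NormedSpace ℝ E]
    {m : ℕ} {r : ℝ} (hr0 : 0 < r) (hr1 : r < 1) {s : Fin m → E →ₗᵢ[ℝ] E} {v : Fin m → E}
    {f : Fin m → E → E} (hf : ∀ k x, f k x = r • (s k x + v k)) {A : Set E}
    (hAcp : IsCompact A) (hA : A = ⋃ k, f k '' A) {x : E} (hx : x ∈ A) :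
    ‖x‖ ≤ r * (⨆ k, ‖v k‖) / (1 - r) := by
  obtain ⟨z, hz, hmax⟩ := hAcp.exists_isMaxOn ⟨x, hx⟩ continuous_norm.continuousOn
  refine (hmax hx).trans ?_
  obtain ⟨k, y, hy, hyz⟩ : ∃ k, ∃ y ∈ A, f k y = z := by
    rw [hA] at hz
    simpa using hz
  have hyle : ‖y‖ ≤ ‖z‖ := hmax hy
  have hvk : ‖v k‖ ≤ ⨆ k, ‖v k‖ := le_ciSup (Finite.bddAbove_range fun k => ‖v k‖) k
  have hzle : ‖z‖ ≤ r * (‖y‖ + ‖v k‖) := by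
    rw [← hyz, hf, norm_smul, Real.norm_of_nonneg hr0.le, ← (s k).norm_map y]
    exact mul_le_mul_of_nonneg_left (norm_add_le _ _) hr0.le
  change ‖z‖ ≤ _
  rw [le_div_iff₀ (sub_pos.2 hr1)]
  nlinarith [mul_le_mul_of_nonneg_left (add_le_add hyle hvk) hr0.le]

/-- **Finite type is equivalent to finiteness of the candidate set `‖v(h)‖ ≤ C`.**
For the IFS `f k x = r • (s k x + v k)` with attractor `A ∋ 0` and
`C = 2r·max‖vₖ‖/(1−r)`, the set of proper neighbor maps is finite iff the set of
all neighbor maps `h` with `‖v(h)‖ ≤ C` is finite, where the translation part of a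
neighbor map `h x = s x + v` is `v = h 0`. -/
theorem finiteType_iff_candidates_finite
    (d : ℕ) (r : ℝ) (hr0 : 0 < r) (hr1 : r < 1)
    (m : ℕ) (hm : 0 < m)
    (s : Fin m → (EuclideanSpace ℝ (Fin d) →ₗᵢ[ℝ] EuclideanSpace ℝ (Fin d)))
    (v : Fin m → EuclideanSpace ℝ (Fin d))
    (f : Fin m → EuclideanSpace ℝ (Fin d) → EuclideanSpace ℝ (Fin d))
    (hf : ∀ k x, f k x = r • (s k x + v k))
    (A : Set (EuclideanSpace ℝ (Fin d))) (hAne : A.Nonempty) (hAcp : IsCompact A)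
    (hA : A = ⋃ k, f k '' A) (h0A : (0 : EuclideanSpace ℝ (Fin d)) ∈ A)
    (C : ℝ) (hC : C = 2 * r * (⨆ k, ‖v k‖) / (1 - r)) :
    {h | h ∈ neighborMaps f ∧ (A ∩ h '' A).Nonempty}.Finite ↔
      {h | h ∈ neighborMaps f ∧ ‖h 0‖ ≤ C}.Finite := by
  have hdist : ∀ i x y, dist (f i x) (f i y) = r * dist x y := fun i x y => by
    rw [hf, hf, dist_smul₀, dist_add_right, (s i).dist_map, Real.norm_of_nonneg hr0.le]
  have hbij : ∀ i, Function.Bijective (f i) := fun i => by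
    refine ⟨fun x y hxy => ?_, fun y => ?_⟩
    · have hd := hdist i x y
      rw [hxy, dist_self, eq_comm, mul_eq_zero, dist_eq_zero] at hd
      exact hd.resolve_left hr0.ne'
    · obtain ⟨x, hx⟩ := (LinearMap.injective_iff_surjective (f := (s i).toLinearMap)).1
        (s i).injective (r⁻¹ • y - v i)
      refine ⟨x, ?_⟩
      rw [hf, show s i x = r⁻¹ • y - v i from hx, sub_add_cancel, smul_inv_smul₀ hr0.ne']
  have hmaps : ∀ i, ∀ x ∈ A, f i x ∈ A := fun i x hx => by
    rw [hA]
    exact Set.mem_iUnion.2 ⟨i, x, hx, rfl⟩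
  constructor
  · intro hfin
    simpa only [dist_zero_left] using
      finite_neighborMaps_dist_le hr0 hr1 hm hdist hbij hAcp hmaps h0A hfin C
  · refine fun hfin => hfin.subset ?_
    rintro h ⟨hh, x, hxA, y, hyA, hyx⟩
    refine ⟨hh, ?_⟩
    have hx := norm_le_of_mem_attractor hr0 hr1 hf hAcp hA hxA
    have hy := norm_le_of_mem_attractor hr0 hr1 hf hAcp hA hyA
    have htri : ‖h 0‖ ≤ ‖x‖ + ‖y‖ := by
      have hd := (isometry_of_mem_neighborMaps hr0 hdist hh).dist_eq 0 y
      rw [hyx, dist_zero_left, dist_eq_norm] at hd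
      linarith [norm_sub_norm_le (h 0) x]
    rw [hC, show 2 * r * (⨆ k, ‖v k‖) / (1 - r) = 2 * (r * (⨆ k, ‖v k‖) / (1 - r)) by ring]
    linarith
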